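/- Let θ_1, ..., θ_d be irrational real numbers, and let a_1, ..., a_d, β_1, ..., β_d be real numbers such that the sequence u_n = Σ_{i=1}^d a_i cos(2π θ_i n + β_i) is not identically zero. Let (r_n) be a real recurrence sequence with r_n → 0 as n → ∞. Then the set {n ∈ ℕ : u_n > r_n} has positive natural density (in particular its natural density exists and is strictly positive). -/

import Mathlib

open Real

/-- A set `A ⊆ ℕ` has natural density `δ` if `#{n ≤ x : n ∈ A}/x → δ` as `x → ∞`. -/
def HasNatDensity (A : Set ℕ) (δ : ℝ) : Prop :=
  Filter.Tendsto (fun x : ℕ => ((A ∩ Set.Iic x).ncard : ℝ) / x) Filter.atTop (nhds δ)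

/-- A real sequence satisfying a linear recurrence with constant real coefficients. -/
def IsLinearRecurrence (f : ℕ → ℝ) : Prop :=
  ∃ h : ℕ, 0 < h ∧ ∃ c : Fin h → ℝ, ∀ n : ℕ, f (n + h) = ∑ k : Fin h, c k * f (n + k)


/-- Cesàro mean. -/
def HasMean (f : ℕ → ℂ) (L : ℂ) : Prop :=
  Filter.Tendsto (fun N : ℕ => (∑ n ∈ Finset.range N, f n) / (N : ℂ)) Filter.atTop (nhds L)

lemma HasMean.add {f g : ℕ → ℂ} {L K : ℂ} (hf : HasMean f L) (hg : HasMean g K) :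
    HasMean (fun n => f n + g n) (L + K) := by
  unfold HasMean at *
  refine (Filter.Tendsto.add hf hg).congr fun N => ?_
  rw [Finset.sum_add_distrib, add_div]

lemma HasMean.const_mul {f : ℕ → ℂ} {L : ℂ} (c : ℂ) (hf : HasMean f L) :
    HasMean (fun n => c * f n) (c * L) := by
  unfold HasMean at *
  refine (Filter.Tendsto.const_mul c hf).congr fun N => ?_
  rw [← Finset.mul_sum, mul_div_assoc]

lemma HasMean.zero : HasMean (fun _ => 0) 0 := by
  simp [HasMean]

lemma HasMean.sum {ι : Type*} (s : Finset ι) (f : ι → ℕ → ℂ) (L : ι → ℂ)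
    (h : ∀ i ∈ s, HasMean (f i) (L i)) :
    HasMean (fun n => ∑ i ∈ s, f i n) (∑ i ∈ s, L i) := by
  classical
  induction s using Finset.induction_on with
  | empty => simpa using HasMean.zero
  | insert a s ha ih =>
    simp only [Finset.sum_insert ha]
    exact (h a (by simp)).add (ih fun i hi => h i (by simp [hi]))

lemma hasMean_char (ζ : ℂ) (hζ : ‖ζ‖ = 1) : HasMean (fun n => ζ ^ n) (if ζ = 1 then 1 else 0) := by
  unfold HasMean
  split_ifs with h
  · subst h
    refine tendsto_const_nhds.congr' ?_
    filter_upwards [Filter.eventually_gt_atTop 0] with N hN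
    have : (N : ℂ) ≠ 0 := by exact_mod_cast hN.ne'
    simp [this]
  · rw [tendsto_zero_iff_norm_tendsto_zero]
    have h1 : Filter.Tendsto (fun N : ℕ => (2 / ‖ζ - 1‖) / (N : ℝ)) Filter.atTop (nhds 0) :=
      tendsto_const_div_atTop_nhds_zero_nat _
    refine squeeze_zero (fun _ => norm_nonneg _) (fun N => ?_) h1
    rw [geom_sum_eq h, norm_div, norm_div, Complex.norm_natCast]
    gcongr
    calc ‖ζ ^ N - 1‖ ≤ ‖ζ ^ N‖ + ‖(1 : ℂ)‖ := norm_sub_le _ _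
      _ = 2 := by rw [norm_pow, hζ]; norm_num

lemma hasMean_closed (f : ℕ → ℂ)
    (h : ∀ η : ℝ, 0 < η → ∃ g : ℕ → ℂ, ∃ L, HasMean g L ∧
      ∀ᶠ N : ℕ in Filter.atTop, ∑ n ∈ Finset.range N, ‖f n - g n‖ ≤ η * N) :
    ∃ L, HasMean f L := by
  have : CauchySeq (fun N : ℕ => (∑ n ∈ Finset.range N, f n) / (N : ℂ)) := by
    rw [Metric.cauchySeq_iff']
    intro ε hε
    obtain ⟨g, L, hg, hfg⟩ := h (ε / 5) (by positivity)
    have hg' := (Metric.tendsto_nhds.1 hg) (ε / 5) (by positivity)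
    have key : ∀ᶠ N : ℕ in Filter.atTop,
        dist ((∑ n ∈ Finset.range N, f n) / (N : ℂ)) L < 2 * (ε / 5) := by
      filter_upwards [hg', hfg, Filter.eventually_gt_atTop 0] with N h1 h2 h3
      have h3' : (0 : ℝ) < N := by exact_mod_cast h3
      have : dist ((∑ n ∈ Finset.range N, f n) / (N : ℂ)) ((∑ n ∈ Finset.range N, g n) / (N : ℂ))
          ≤ ε / 5 := by
        rw [dist_eq_norm, ← sub_div, ← Finset.sum_sub_distrib, norm_div, Complex.norm_natCast,
          div_le_iff₀ h3']
        exact (norm_sum_le _ _).trans h2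
      linarith [dist_triangle ((∑ n ∈ Finset.range N, f n) / (N : ℂ))
        ((∑ n ∈ Finset.range N, g n) / (N : ℂ)) L]
    obtain ⟨N0, hN0⟩ := Filter.eventually_atTop.1 key
    refine ⟨N0, fun n hn => ?_⟩
    have := hN0 n hn
    have h2 := hN0 N0 le_rfl
    linarith [dist_triangle_right ((∑ n ∈ Finset.range n, f n) / (n : ℂ))
        ((∑ n ∈ Finset.range N0, f n) / (N0 : ℂ)) L]
  exact cauchySeq_tendsto_of_complete this

lemma sum_range_mul' (f : ℕ → ℂ) (M q : ℕ) :
    ∑ n ∈ Finset.range (M * q), f n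
      = ∑ a ∈ Finset.range M, ∑ m ∈ Finset.range q, f (M * m + a) := by
  induction q with
  | zero => simp
  | succ q ih =>
    rw [Nat.mul_succ, Finset.sum_range_add, ih, ← Finset.sum_add_distrib]
    exact Finset.sum_congr rfl fun a _ => (Finset.sum_range_succ _ _).symm

lemma hasMean_of_progressions (f : ℕ → ℂ) (C : ℝ) (hC : ∀ n, ‖f n‖ ≤ C) (M : ℕ) (hM : 0 < M)
    (h : ∀ a < M, ∃ L, HasMean (fun m => f (M * m + a)) L) : ∃ L, HasMean f L := by
  choose! L hL using h
  have hs := HasMean.sum (Finset.range M) (fun a m => f (M * m + a)) L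
    (fun a ha => hL a (Finset.mem_range.1 ha))
  have hdiv : Filter.Tendsto (fun N : ℕ => N / M) Filter.atTop Filter.atTop :=
    Nat.tendsto_div_const_atTop hM.ne'
  have h1 := Filter.Tendsto.comp hs hdiv
  have hr : Filter.Tendsto (fun N : ℕ => (((N / M : ℕ) : ℝ) / (N : ℝ))) Filter.atTop
      (nhds (1 / (M : ℝ))) := by
    have := (tendsto_nat_floor_mul_div_atTop (R := ℝ) (a := 1 / (M : ℝ)) (by positivity)).comp
      tendsto_natCast_atTop_atTop
    refine this.congr fun N => ?_
    simp only [Function.comp]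
    congr 2
    rw [← Nat.floor_div_eq_div (K := ℝ)]
    congr 1
    ring
  have hr' : Filter.Tendsto (fun N : ℕ => (((N / M : ℕ) : ℂ) / (N : ℂ))) Filter.atTop
      (nhds (1 / (M : ℂ))) := by
    have := (Complex.continuous_ofReal.tendsto _).comp hr
    simpa [Function.comp_def] using this
  have h2 := h1.mul hr'
  have h3 : Filter.Tendsto (fun N : ℕ => (∑ n ∈ Finset.Ico (M * (N / M)) N, f n) / (N : ℂ))
      Filter.atTop (nhds 0) := by
    rw [tendsto_zero_iff_norm_tendsto_zero]
    have h1 : Filter.Tendsto (fun N : ℕ => (M * C) / (N : ℝ)) Filter.atTop (nhds 0) :=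
      tendsto_const_div_atTop_nhds_zero_nat _
    refine squeeze_zero (fun _ => norm_nonneg _) (fun N => ?_) h1
    rw [norm_div, Complex.norm_natCast]
    gcongr
    have hC0 : 0 ≤ C := (norm_nonneg _).trans (hC 0)
    calc ‖∑ n ∈ Finset.Ico (M * (N / M)) N, f n‖ ≤ ∑ n ∈ Finset.Ico (M * (N / M)) N, C :=
          norm_sum_le_of_le _ fun n _ => hC n
      _ = (N - M * (N / M) : ℕ) * C := by simp
      _ ≤ M * C := by
        gcongr
        have := Nat.mod_lt N hM
        have := Nat.div_add_mod N M
        omega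
  refine ⟨_, (h2.add h3).congr' ?_⟩
  filter_upwards [Filter.eventually_ge_atTop M] with N hN
  have hq : ((N / M : ℕ) : ℂ) ≠ 0 := by
    have := Nat.div_pos hN hM
    exact_mod_cast this.ne'
  simp only [Function.comp]
  rw [div_mul_div_cancel₀ hq, ← add_div, Finset.sum_comm, ← sum_range_mul',
    Finset.sum_range_add_sum_Ico _ (Nat.mul_div_le N M)]

/-- The characters `n ↦ ζ ^ n`, `‖ζ‖ = 1`. -/
def charMon : Submonoid (ℕ → ℂ) where
  carrier := {f | ∃ ζ : ℂ, ‖ζ‖ = 1 ∧ f = fun n => ζ ^ n}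
  one_mem' := ⟨1, by simp, by ext; simp⟩
  mul_mem' := by
    rintro _ _ ⟨a, ha, rfl⟩ ⟨b, hb, rfl⟩
    exact ⟨a * b, by simp [ha, hb], by ext; simp [mul_pow]⟩

/-- Trigonometric polynomials. -/
noncomputable def TP : Subalgebra ℂ (ℕ → ℂ) := Algebra.adjoin ℂ (charMon : Set (ℕ → ℂ))

lemma char_mem_TP (ζ : ℂ) (h : ‖ζ‖ = 1) : (fun n : ℕ => ζ ^ n) ∈ TP :=
  Algebra.subset_adjoin ⟨ζ, h, rfl⟩

lemma sum_mem_TP {ι : Type*} (S : Finset ι) (ζ : ι → ℂ) (c : ι → ℂ) (h : ∀ i ∈ S, ‖ζ i‖ = 1) :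
    (fun n : ℕ => ∑ i ∈ S, c i * ζ i ^ n) ∈ TP := by
  have : (fun n : ℕ => ∑ i ∈ S, c i * ζ i ^ n) = ∑ i ∈ S, c i • (fun n : ℕ => ζ i ^ n) := by
    ext n; simp
  rw [this]
  exact Subalgebra.sum_mem _ fun i hi => Subalgebra.smul_mem _ (char_mem_TP _ (h i hi)) _

lemma hasMean_TP (f : ℕ → ℂ) (hf : f ∈ TP) : ∃ L, HasMean f L := by
  have hf' : f ∈ Submodule.span ℂ (charMon : Set (ℕ → ℂ)) := by
    have := Algebra.adjoin_eq_span ℂ (charMon : Set (ℕ → ℂ))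
    rw [Submonoid.closure_eq] at this
    rw [← this]; exact hf
  induction hf' using Submodule.span_induction with
  | mem x hx => obtain ⟨ζ, h, rfl⟩ := hx; exact ⟨_, hasMean_char ζ h⟩
  | zero => exact ⟨0, HasMean.zero⟩
  | add x y hx hy ihx ihy =>
    have e := Algebra.adjoin_eq_span ℂ (charMon : Set (ℕ → ℂ))
    rw [Submonoid.closure_eq] at e
    obtain ⟨L, hL⟩ := ihx (by rw [← e] at hx; exact hx)
    obtain ⟨K, hK⟩ := ihy (by rw [← e] at hy; exact hy)
    exact ⟨_, hL.add hK⟩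
  | smul a x hx ih =>
    have e := Algebra.adjoin_eq_span ℂ (charMon : Set (ℕ → ℂ))
    rw [Submonoid.closure_eq] at e
    obtain ⟨L, hL⟩ := ih (by rw [← e] at hx; exact hx)
    exact ⟨_, hL.const_mul a⟩

lemma re_mem_TP {ι : Type*} (S : Finset ι) (ζ : ι → ℂ) (c : ι → ℂ) (h : ∀ i ∈ S, ‖ζ i‖ = 1) :
    (fun n : ℕ => (((∑ i ∈ S, c i * ζ i ^ n).re : ℝ) : ℂ)) ∈ TP := by
  have h1 := sum_mem_TP S ζ c h
  have h2 := sum_mem_TP S (fun i => (starRingEnd ℂ) (ζ i)) (fun i => (starRingEnd ℂ) (c i))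
    (fun i hi => by rw [RCLike.norm_conj]; exact h i hi)
  have := Subalgebra.smul_mem _ (Subalgebra.add_mem _ h1 h2) (1 / 2 : ℂ)
  convert this using 1
  ext n
  rw [Complex.re_eq_add_conj]
  simp only [Pi.smul_apply, Pi.add_apply, smul_eq_mul, map_sum, map_mul, map_pow]
  ring

lemma poly_mem_TP (p : Polynomial ℝ) (x : ℕ → ℝ) (hx : (fun n => (x n : ℂ)) ∈ TP) :
    (fun n => ((p.eval (x n) : ℝ) : ℂ)) ∈ TP := by
  have : (fun n => ((p.eval (x n) : ℝ) : ℂ))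
      = Polynomial.aeval (fun n => (x n : ℂ)) (p.map (algebraMap ℝ ℂ)) := by
    ext n
    have e := Polynomial.aeval_algHom_apply (Pi.evalAlgHom ℂ (fun _ : ℕ => ℂ) n)
      (fun n => (x n : ℂ)) (p.map (algebraMap ℝ ℂ))
    simp only [Pi.evalAlgHom_apply] at e
    rw [← e, Polynomial.aeval_map_algebraMap, Polynomial.aeval_def]
    have := Polynomial.eval₂_at_apply (p := p) Complex.ofRealHom (x n)
    exact this.symm
  rw [this]
  have h := Polynomial.aeval_algHom_apply TP.val (⟨_, hx⟩ : TP) (p.map (algebraMap ℝ ℂ))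
  simp only [Subalgebra.coe_val] at h
  rw [h]
  exact Subtype.property _

open Classical in
lemma count_gap (B : ℕ → Prop) (H N : ℕ) :
    ((Finset.range N).filter B).card ≤ N / (H + 1) + 1 +
      ∑ h ∈ Finset.Icc 1 H, ((Finset.range N).filter (fun n => B n ∧ B (n + h))).card := by
  set G := (Finset.range N).filter (fun n => B n ∧ ∀ h ∈ Finset.Icc 1 H, ¬ B (n + h)) with hG
  have hsub : (Finset.range N).filter B ⊆ G ∪ (Finset.Icc 1 H).biUnion
      (fun h => (Finset.range N).filter (fun n => B n ∧ B (n + h))) := by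
    intro n hn
    simp only [Finset.mem_filter, Finset.mem_union, Finset.mem_biUnion, hG] at hn ⊢
    by_cases hh : ∀ h ∈ Finset.Icc 1 H, ¬ B (n + h)
    · exact Or.inl ⟨hn.1, hn.2, hh⟩
    · push Not at hh
      obtain ⟨h, h1, h2⟩ := hh
      exact Or.inr ⟨h, h1, hn.1, hn.2, h2⟩
  have hGc : G.card ≤ N / (H + 1) + 1 := by
    rw [← Finset.card_range (N / (H + 1) + 1)]
    apply Finset.card_le_card_of_injOn (fun m => m / (H + 1))
    · intro m hm
      simp only [hG, Finset.coe_filter, Set.mem_ofPred_eq, Finset.mem_range] at hm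
      simp only [Finset.coe_range, Set.mem_Iio]
      exact Nat.lt_succ_of_le (Nat.div_le_div_right hm.1.le)
    · have key : ∀ m ∈ G, ∀ k ∈ G, m / (H + 1) = k / (H + 1) → ¬ m < k := by
        intro m hm k hk e hlt
        simp only [hG, Finset.mem_filter] at hm hk
        refine hm.2.2 (k - m) ?_ ?_
        · have h1 := Nat.div_add_mod m (H + 1)
          have h2 := Nat.div_add_mod k (H + 1)
          have h3 := Nat.mod_lt k (Nat.succ_pos H)
          rw [e] at h1
          rw [Finset.mem_Icc]
          simp only [Nat.succ_eq_add_one] at h3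
          omega
        · rw [Nat.add_sub_cancel' hlt.le]; exact hk.2.1
      intro m hm k hk e
      have h1 := key m hm k hk e
      have h2 := key k hk m hm e.symm
      omega
  calc _ ≤ _ := Finset.card_le_card hsub
    _ ≤ _ := Finset.card_union_le _ _
    _ ≤ _ := add_le_add hGc Finset.card_biUnion_le

open Classical in
lemma small_values (S : Finset ℂ) (hne : S.Nonempty) : ∀ (c : ℂ → ℂ), (∀ ζ ∈ S, ‖ζ‖ = 1) →
    (∀ ζ ∈ S, c ζ ≠ 0) →
    (∀ ζ ∈ S, ∀ ξ ∈ S, ∀ h : ℕ, 0 < h → ζ ^ h = ξ ^ h → ζ = ξ) →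
    ∀ η : ℝ, 0 < η → ∃ δ : ℝ, 0 < δ ∧ ∀ᶠ N : ℕ in Filter.atTop,
      (((Finset.range N).filter (fun n => ‖∑ ζ ∈ S, c ζ * ζ ^ n‖ ≤ δ)).card : ℝ) ≤ η * N := by
  induction hne using Finset.Nonempty.cons_induction with
  | singleton a =>
    intro c h1 hc _ η hη
    have hca := hc a (by simp)
    have h1a := h1 a (by simp)
    refine ⟨‖c a‖ / 2, by positivity, Filter.Eventually.of_forall fun N => ?_⟩
    rw [Finset.filter_false_of_mem]
    · simp; positivity
    · intro n _
      have : 0 < ‖c a‖ := by positivity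
      simp [h1a]
      exact hca
  | cons a s ha hs ih =>
    intro c h1 hc hnd η hη
    obtain ⟨H, hH⟩ := exists_nat_one_div_lt (show 0 < η / 3 by positivity)
    have hstep : ∀ h ∈ Finset.Icc 1 H, ∃ δ : ℝ, 0 < δ ∧ ∀ᶠ N : ℕ in Filter.atTop,
      (((Finset.range N).filter
        (fun n => ‖∑ ζ ∈ s, (c ζ * (ζ ^ h - a ^ h)) * ζ ^ n‖ ≤ δ)).card : ℝ)
          ≤ (η / (3 * (H + 1))) * N := by
      intro h hh
      rw [Finset.mem_Icc] at hh
      refine ih (fun ζ => c ζ * (ζ ^ h - a ^ h)) (fun ζ hζ => h1 ζ (by simp [hζ])) ?_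
        (fun ζ hζ ξ hξ => hnd ζ (by simp [hζ]) ξ (by simp [hξ])) _ (by positivity)
      intro ζ hζ
      refine mul_ne_zero (hc ζ (by simp [hζ])) (sub_ne_zero.2 fun e => ha ?_)
      rwa [← hnd ζ (by simp [hζ]) a (by simp) h hh.1 e]
    choose! D hD0 hD using hstep
    obtain ⟨δ, hδ0, hδ⟩ : ∃ δ : ℝ, 0 < δ ∧ ∀ h ∈ Finset.Icc 1 H, 2 * δ ≤ D h := by
      by_cases hI : (Finset.Icc 1 H).Nonempty
      · refine ⟨(Finset.Icc 1 H).inf' hI D / 2, ?_, fun h hh => ?_⟩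
        · have : 0 < (Finset.Icc 1 H).inf' hI D := by
            rw [Finset.lt_inf'_iff]; exact hD0
          positivity
        · have := Finset.inf'_le D hh
          linarith
      · refine ⟨1, one_pos, fun h hh => absurd ⟨h, hh⟩ hI⟩
    refine ⟨δ, hδ0, ?_⟩
    have hall : ∀ᶠ N : ℕ in Filter.atTop, ∀ h ∈ Finset.Icc 1 H,
      (((Finset.range N).filter
        (fun n => ‖∑ ζ ∈ s, (c ζ * (ζ ^ h - a ^ h)) * ζ ^ n‖ ≤ D h)).card : ℝ)
          ≤ (η / (3 * (H + 1))) * N := by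
      rw [Filter.eventually_all_finset]
      exact hD
    have hbig : ∀ᶠ N : ℕ in Filter.atTop, 3 / η ≤ (N : ℝ) :=
      tendsto_natCast_atTop_atTop.eventually_ge_atTop _
    filter_upwards [hall, hbig] with N hN hNb
    have hcg := count_gap (fun n => ‖∑ ζ ∈ Finset.cons a s ha, c ζ * ζ ^ n‖ ≤ δ) H N
    have hcg' : (((Finset.range N).filter
        (fun n => ‖∑ ζ ∈ Finset.cons a s ha, c ζ * ζ ^ n‖ ≤ δ)).card : ℝ)
        ≤ (N / (H + 1) : ℕ) + 1 + ∑ h ∈ Finset.Icc 1 H, (η / (3 * (H + 1))) * N := by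
      refine (Nat.cast_le.2 hcg).trans ?_
      push_cast
      gcongr with h hh
      refine le_trans ?_ (hN h hh)
      rw [Nat.cast_le]
      apply Finset.card_le_card
      intro n hn
      simp only [Finset.mem_filter] at hn ⊢
      refine ⟨hn.1, ?_⟩
      obtain ⟨_, hn1, hn2⟩ := hn
      have e : ∑ ζ ∈ s, (c ζ * (ζ ^ h - a ^ h)) * ζ ^ n =
          (∑ ζ ∈ Finset.cons a s ha, c ζ * ζ ^ (n + h))
            - a ^ h * ∑ ζ ∈ Finset.cons a s ha, c ζ * ζ ^ n := by
        rw [Finset.sum_cons, Finset.sum_cons, mul_add, Finset.mul_sum]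
        have : ∑ ζ ∈ s, (c ζ * (ζ ^ h - a ^ h)) * ζ ^ n
          = ∑ ζ ∈ s, c ζ * ζ ^ (n + h) - ∑ ζ ∈ s, a ^ h * (c ζ * ζ ^ n) := by
          rw [← Finset.sum_sub_distrib]
          exact Finset.sum_congr rfl fun _ _ => by ring
        rw [this]
        ring
      rw [e]
      refine (norm_sub_le _ _).trans ?_
      rw [norm_mul, norm_pow, h1 a (by simp), one_pow, one_mul]
      have := hδ h hh
      linarith
    refine hcg'.trans ?_
    rw [Finset.sum_const, Nat.card_Icc, nsmul_eq_mul, Nat.add_sub_cancel]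
    have hN0 : (0 : ℝ) ≤ N := Nat.cast_nonneg N
    have a1 : ((N / (H + 1) : ℕ) : ℝ) ≤ η / 3 * N := by
      refine (Nat.cast_div_le).trans ?_
      push_cast
      calc (N : ℝ) / (H + 1) = (1 / ((H : ℝ) + 1)) * N := by ring
        _ ≤ _ := by gcongr
    have a2 : 1 ≤ η / 3 * N := by
      rw [div_le_iff₀ hη] at hNb
      linarith
    have a3 : (H : ℝ) * (η / (3 * (H + 1)) * N) ≤ η / 3 * N := by
      have : (H : ℝ) * (η / (3 * (H + 1)) * N) = (H / (H + 1) : ℝ) * (η / 3 * N) := by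
        field_simp
      rw [this]
      refine mul_le_of_le_one_left (by positivity) ?_
      rw [div_le_one (by positivity)]
      linarith
    linarith

lemma HasMean.congr' {f g : ℕ → ℂ} {L : ℂ} (hf : HasMean f L) (h : ∀ᶠ n in Filter.atTop, f n = g n) :
    HasMean g L := by
  obtain ⟨n0, hn0⟩ := Filter.eventually_atTop.1 h
  have h1 : Filter.Tendsto (fun N : ℕ => (∑ n ∈ Finset.range n0, (g n - f n)) / (N : ℂ))
      Filter.atTop (nhds 0) := tendsto_const_div_atTop_nhds_zero_nat _
  have h2 := Filter.Tendsto.add hf h1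
  rw [add_zero] at h2
  refine h2.congr' ?_
  filter_upwards [Filter.eventually_ge_atTop n0] with N hN
  have : ∑ n ∈ Finset.range n0, (g n - f n) = ∑ n ∈ Finset.range N, (g n - f n) := by
    apply Finset.sum_subset
    · simpa using hN
    · intro n _ hn
      rw [Finset.mem_range, not_lt] at hn
      rw [hn0 n hn, sub_self]
  rw [this, ← add_div, ← Finset.sum_add_distrib]
  simp

open Classical in
lemma density_dominant (y : ℕ → ℝ) (S : Finset ℂ) (hne : S.Nonempty) (c : ℂ → ℂ)
    (h1 : ∀ ζ ∈ S, ‖ζ‖ = 1) (hc : ∀ ζ ∈ S, c ζ ≠ 0)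
    (hnd : ∀ ζ ∈ S, ∀ ξ ∈ S, ∀ h : ℕ, 0 < h → ζ ^ h = ξ ^ h → ζ = ξ)
    (hy : Filter.Tendsto (fun n => (y n : ℂ) - ∑ ζ ∈ S, c ζ * ζ ^ n) Filter.atTop (nhds 0)) :
    ∃ L, HasMean (fun n => if 0 < y n then 1 else 0) L := by
  apply hasMean_closed
  intro η hη
  obtain ⟨δ', hδ', hsm⟩ := small_values S hne c h1 hc hnd (η / 3) (by positivity)
  set δ := δ' / 2 with hδdef
  have hδ : 0 < δ := by positivity
  set v : ℕ → ℂ := fun n => ∑ ζ ∈ S, c ζ * ζ ^ n with hv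
  set C : ℝ := ∑ ζ ∈ S, ‖c ζ‖ with hC
  have hvC : ∀ n, ‖v n‖ ≤ C := by
    intro n
    refine norm_sum_le_of_le _ fun ζ hζ => ?_
    rw [norm_mul, norm_pow, h1 ζ hζ, one_pow, mul_one]
  let F : ℝ → ℝ := fun t => max 0 (min 1 (t / δ))
  have hF : Continuous F := by fun_prop
  have hF01 : ∀ t, 0 ≤ F t ∧ F t ≤ 1 := fun t =>
    ⟨le_max_left _ _, max_le zero_le_one (min_le_left _ _)⟩
  obtain ⟨p, hp⟩ := exists_polynomial_near_of_continuousOn (-C) C F hF.continuousOn (η / 3)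
    (by positivity)
  have hTP := poly_mem_TP p (fun n => (v n).re) (re_mem_TP S (fun ζ => ζ) c h1)
  obtain ⟨L, hL⟩ := hasMean_TP _ hTP
  refine ⟨_, L, hL, ?_⟩
  obtain ⟨m0, hm0⟩ := Filter.eventually_atTop.1 ((Metric.tendsto_nhds.1 hy) δ hδ)
  have hpt : ∀ n, ‖(if 0 < y n then (1 : ℂ) else 0) - ((p.eval (v n).re : ℝ) : ℂ)‖ ≤
      (if ‖v n‖ ≤ δ' then (1 : ℝ) else 0) + η / 3 + (if n < m0 then (1 : ℝ) else 0) := by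
    intro n
    have hre : (v n).re ∈ Set.Icc (-C) C := by
      have := (Complex.abs_re_le_norm (v n)).trans (hvC n)
      exact abs_le.1 this
    have hpn := hp _ hre
    have e : (if 0 < y n then (1 : ℂ) else 0) = (((if 0 < y n then (1 : ℝ) else 0) : ℝ) : ℂ) := by
      split_ifs <;> simp
    rw [e, ← Complex.ofReal_sub, Complex.norm_real, Real.norm_eq_abs]
    have key : |(if 0 < y n then (1 : ℝ) else 0) - F (v n).re| ≤
        (if ‖v n‖ ≤ δ' then (1 : ℝ) else 0) + (if n < m0 then (1 : ℝ) else 0) := by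
      have triv : |(if 0 < y n then (1 : ℝ) else 0) - F (v n).re| ≤ 1 := by
        have := hF01 (v n).re
        rw [abs_le]
        split_ifs <;> constructor <;> linarith
      by_cases hn : n < m0
      · rw [if_pos hn]
        have : (0 : ℝ) ≤ (if ‖v n‖ ≤ δ' then (1 : ℝ) else 0) := by split_ifs <;> norm_num
        linarith
      by_cases hvn : ‖v n‖ ≤ δ'
      · rw [if_pos hvn, if_neg hn]; linarith
      rw [if_neg hn, if_neg hvn]
      have hd := hm0 n (not_lt.1 hn)
      rw [dist_zero_right] at hd
      have hdre := (Complex.abs_re_le_norm _).trans_lt hd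
      have hdim := (Complex.abs_im_le_norm _).trans_lt hd
      simp only [Complex.sub_re, Complex.ofReal_re, Complex.sub_im, Complex.ofReal_im] at hdre hdim
      change |y n - (v n).re| < δ at hdre
      change |0 - (v n).im| < δ at hdim
      rw [zero_sub, abs_neg] at hdim
      have hbig : δ < |(v n).re| := by
        have := Complex.norm_le_abs_re_add_abs_im (v n)
        have h2 : δ' = 2 * δ := by rw [hδdef]; ring
        linarith [not_le.1 hvn]
      rw [abs_lt] at hdre
      rcases lt_abs.1 hbig with hb | hb
      · have : F (v n).re = 1 := by
          have : 1 ≤ (v n).re / δ := by rw [le_div_iff₀ hδ]; linarith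
          simp [F, this]
        rw [this, if_pos (by linarith)]
        simp
      · have : F (v n).re = 0 := by
          have : (v n).re / δ ≤ 0 := div_nonpos_of_nonpos_of_nonneg (by linarith) hδ.le
          simp [F, this]
        rw [this, if_neg (by linarith)]
        simp
    have := abs_sub_le (if 0 < y n then (1 : ℝ) else 0) (F (v n).re) (p.eval (v n).re)
    rw [abs_sub_comm (F _)] at this
    linarith
  have hbig : ∀ᶠ N : ℕ in Filter.atTop, m0 / (η / 3) ≤ (N : ℝ) :=
    tendsto_natCast_atTop_atTop.eventually_ge_atTop _
  filter_upwards [hsm, hbig] with N hN hNb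
  refine (Finset.sum_le_sum fun n _ => hpt n).trans ?_
  rw [Finset.sum_add_distrib, Finset.sum_add_distrib, Finset.sum_boole, Finset.sum_boole,
    Finset.sum_const, Finset.card_range, nsmul_eq_mul]
  have a1 : (((Finset.range N).filter (fun n => n < m0)).card : ℝ) ≤ m0 := by
    rw [Nat.cast_le]
    calc _ ≤ (Finset.range m0).card := Finset.card_le_card (by
            intro n hn; simp at hn ⊢; exact hn.2)
      _ = m0 := Finset.card_range _
  rw [div_le_iff₀ (by positivity)] at hNb
  linarith

lemma poly_div_tendsto (P : Polynomial ℂ) (k : ℕ) (hk : P.natDegree ≤ k) :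
    Filter.Tendsto (fun n : ℕ => P.eval (n : ℂ) / (n : ℂ) ^ k) Filter.atTop (nhds (P.coeff k)) := by
  have : ∀ i ∈ Finset.range (k + 1), Filter.Tendsto
      (fun n : ℕ => P.coeff i * ((n : ℂ) ^ i / (n : ℂ) ^ k)) Filter.atTop
      (nhds (if i = k then P.coeff k else 0)) := by
    intro i hi
    split_ifs with h
    · subst h
      refine tendsto_const_nhds.congr' ?_
      filter_upwards [Filter.eventually_gt_atTop 0] with n hn
      have : (n : ℂ) ≠ 0 := by exact_mod_cast hn.ne'
      rw [div_self (pow_ne_zero _ this), mul_one]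
    · have hlt : i < k := by
        rw [Finset.mem_range] at hi; omega
      have hb : Filter.Tendsto (fun n : ℕ => (n : ℂ) ^ i / (n : ℂ) ^ k) Filter.atTop (nhds 0) := by
        rw [tendsto_zero_iff_norm_tendsto_zero]
        have := (tendsto_pow_div_pow_atTop_zero (𝕜 := ℝ) hlt).comp tendsto_natCast_atTop_atTop
        refine this.congr fun n => ?_
        simp
      simpa using hb.const_mul (P.coeff i)
  have h := tendsto_finsetSum _ this
  rw [Finset.sum_ite_eq' , if_pos (by simp)] at h
  refine h.congr fun n => ?_
  rw [Polynomial.eval_eq_sum_range' (Nat.lt_succ_of_le hk), Finset.sum_div]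
  exact Finset.sum_congr rfl fun i _ => by ring

lemma poly_mul_geom_tendsto (P : Polynomial ℂ) (q : ℂ) (hq : ‖q‖ < 1) :
    Filter.Tendsto (fun n : ℕ => P.eval (n : ℂ) * q ^ n) Filter.atTop (nhds 0) := by
  have : ∀ i ∈ Finset.range (P.natDegree + 1), Filter.Tendsto
      (fun n : ℕ => P.coeff i * ((n : ℂ) ^ i * q ^ n)) Filter.atTop (nhds 0) := by
    intro i _
    have hb : Filter.Tendsto (fun n : ℕ => (n : ℂ) ^ i * q ^ n) Filter.atTop (nhds 0) := by
      rw [tendsto_zero_iff_norm_tendsto_zero]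
      have := tendsto_pow_const_mul_const_pow_of_abs_lt_one i (r := ‖q‖) (by simpa using hq)
      refine this.congr fun n => ?_
      simp
    simpa using hb.const_mul (P.coeff i)
  have h := tendsto_finsetSum _ this
  rw [Finset.sum_const_zero] at h
  refine h.congr fun n => ?_
  rw [Polynomial.eval_eq_sum_range, Finset.sum_mul]
  exact Finset.sum_congr rfl fun i _ => by ring

open Classical in
lemma density_nondegenerate (y : ℕ → ℝ) (S : Finset ℂ) (P : ℂ → Polynomial ℂ)
    (h0 : ∀ ζ ∈ S, ζ ≠ 0)
    (hnd : ∀ ζ ∈ S, ∀ ξ ∈ S, ∀ h : ℕ, 0 < h → ζ ^ h = ξ ^ h → ζ = ξ)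
    (hy : ∀ᶠ n : ℕ in Filter.atTop, (y n : ℂ) = ∑ ζ ∈ S, (P ζ).eval (n : ℂ) * ζ ^ n) :
    ∃ L, HasMean (fun n => if 0 < y n then 1 else 0) L := by
  set S0 := S.filter (fun ζ => P ζ ≠ 0) with hS0
  have hy0 : ∀ᶠ n : ℕ in Filter.atTop, (y n : ℂ) = ∑ ζ ∈ S0, (P ζ).eval (n : ℂ) * ζ ^ n := by
    filter_upwards [hy] with n hn
    rw [hn, hS0, Finset.sum_filter]
    refine Finset.sum_congr rfl fun ζ _ => ?_
    split_ifs with h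
    · rfl
    · push Not at h; simp [h]
  rcases S0.eq_empty_or_nonempty with hemp | hne
  · refine ⟨0, HasMean.zero.congr' ?_⟩
    filter_upwards [hy0] with n hn
    rw [hemp, Finset.sum_empty] at hn
    have : y n = 0 := by exact_mod_cast hn
    simp [this]
  obtain ⟨μ0, hμ0, hmax⟩ := S0.exists_max_image (fun ζ => ‖ζ‖) hne
  set ρ := ‖μ0‖ with hρ
  have hρ0 : 0 < ρ := by
    rw [hρ, norm_pos_iff]; exact h0 _ (Finset.mem_filter.1 hμ0).1
  have hρc : (ρ : ℂ) ≠ 0 := by exact_mod_cast hρ0.ne'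
  obtain ⟨μ1, hμ1, hmax1⟩ := (S0.filter (fun ζ => ‖ζ‖ = ρ)).exists_max_image
    (fun ζ => (P ζ).natDegree) ⟨μ0, by simp [hμ0, hρ]⟩
  set k := (P μ1).natDegree with hk
  set T := S0.filter (fun ζ => ‖ζ‖ = ρ ∧ (P ζ).coeff k ≠ 0) with hT
  have hTne : T.Nonempty := by
    refine ⟨μ1, ?_⟩
    rw [Finset.mem_filter] at hμ1
    rw [hT, Finset.mem_filter]
    refine ⟨hμ1.1, hμ1.2, ?_⟩
    rw [hk, Polynomial.coeff_natDegree, Polynomial.leadingCoeff_ne_zero]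
    exact (Finset.mem_filter.1 hμ1.1).2
  have hTS : ∀ ζ ∈ T, ζ ∈ S := fun ζ hζ => (Finset.mem_filter.1 (Finset.mem_filter.1 hζ).1).1
  have hinj : Function.Injective (fun ζ : ℂ => ζ / (ρ : ℂ)) := fun a b hab => by
    simpa [hρc] using hab
  set U := T.image (fun ζ => ζ / (ρ : ℂ)) with hU
  have hyz : ∃ L, HasMean (fun n => if 0 < y n / ((n : ℝ) ^ k * ρ ^ n) then 1 else 0) L := by
    refine density_dominant (fun n => y n / ((n : ℝ) ^ k * ρ ^ n)) U (hTne.image _)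
      (fun ζ => (P (ζ * ρ)).coeff k) ?_ ?_ ?_ ?_
    · intro ζ hζ
      obtain ⟨μ, hμ, rfl⟩ := Finset.mem_image.1 hζ
      rw [hT, Finset.mem_filter] at hμ
      rw [norm_div, hμ.2.1, Complex.norm_real, Real.norm_of_nonneg hρ0.le, div_self hρ0.ne']
    · intro ζ hζ
      obtain ⟨μ, hμ, rfl⟩ := Finset.mem_image.1 hζ
      rw [hT, Finset.mem_filter] at hμ
      rw [div_mul_cancel₀ _ hρc]
      exact hμ.2.2
    · intro ζ hζ ξ hξ h hh he
      obtain ⟨μ, hμ, rfl⟩ := Finset.mem_image.1 hζ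
      obtain ⟨ν, hν, rfl⟩ := Finset.mem_image.1 hξ
      rw [div_pow, div_pow, div_left_inj' (pow_ne_zero _ hρc)] at he
      rw [hnd μ (hTS _ hμ) ν (hTS _ hν) h hh he]
    · have hterm : ∀ ζ ∈ S0, Filter.Tendsto (fun n : ℕ =>
          (P ζ).eval (n : ℂ) * ζ ^ n / ((n : ℂ) ^ k * (ρ : ℂ) ^ n)
            - (if ‖ζ‖ = ρ ∧ (P ζ).coeff k ≠ 0 then (P ζ).coeff k * (ζ / ρ) ^ n else 0))
          Filter.atTop (nhds 0) := by
        intro ζ hζ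
        by_cases hn : ‖ζ‖ = ρ
        · have hd : (P ζ).natDegree ≤ k := hmax1 ζ (by simp [hζ, hn])
          have := (poly_div_tendsto (P ζ) k hd).sub_const ((P ζ).coeff k)
          rw [sub_self, tendsto_zero_iff_norm_tendsto_zero] at this
          rw [tendsto_zero_iff_norm_tendsto_zero]
          refine this.congr fun n => ?_
          have e : (P ζ).eval (n : ℂ) * ζ ^ n / ((n : ℂ) ^ k * (ρ : ℂ) ^ n)
            - (if ‖ζ‖ = ρ ∧ (P ζ).coeff k ≠ 0 then (P ζ).coeff k * (ζ / ρ) ^ n else 0)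
            = ((P ζ).eval (n : ℂ) / (n : ℂ) ^ k - (P ζ).coeff k) * (ζ / ρ) ^ n := by
            have : (if ‖ζ‖ = ρ ∧ (P ζ).coeff k ≠ 0 then (P ζ).coeff k * (ζ / ρ) ^ n else 0)
              = (P ζ).coeff k * (ζ / ρ) ^ n := by
              split_ifs with h
              · rfl
              · have : (P ζ).coeff k = 0 := by
                  by_contra h'; exact h ⟨hn, h'⟩
                simp [this]
            rw [this, div_pow, mul_div_mul_comm]
            ring
          rw [e, norm_mul, norm_pow, norm_div, hn, Complex.norm_real,
            Real.norm_of_nonneg hρ0.le, div_self hρ0.ne', one_pow, mul_one]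
        · have hlt : ‖ζ / (ρ : ℂ)‖ < 1 := by
            rw [norm_div, Complex.norm_real, Real.norm_of_nonneg hρ0.le, div_lt_one hρ0]
            exact lt_of_le_of_ne (hmax ζ hζ) hn
          have := poly_mul_geom_tendsto (P ζ) _ hlt
          rw [tendsto_zero_iff_norm_tendsto_zero] at this
          rw [tendsto_zero_iff_norm_tendsto_zero]
          refine squeeze_zero' (Filter.Eventually.of_forall fun _ => norm_nonneg _) ?_ this
          filter_upwards [Filter.eventually_gt_atTop 0] with n hn'
          rw [if_neg (fun h => hn h.1), sub_zero]
          have e : (P ζ).eval (n : ℂ) * ζ ^ n / ((n : ℂ) ^ k * (ρ : ℂ) ^ n)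
            = (P ζ).eval (n : ℂ) * (ζ / ρ) ^ n / (n : ℂ) ^ k := by
            rw [div_pow, mul_comm ((n : ℂ) ^ k), ← div_div, mul_div_assoc]
          rw [e, norm_div]
          apply div_le_self (norm_nonneg _)
          rw [norm_pow, Complex.norm_natCast]
          exact one_le_pow₀ (by exact_mod_cast hn')
      have h := tendsto_finsetSum _ hterm
      rw [Finset.sum_const_zero] at h
      refine h.congr' ?_
      filter_upwards [hy0] with n hn
      rw [Finset.sum_sub_distrib, ← Finset.sum_filter, ← hT, hU,
        Finset.sum_image (fun a _ b _ hab => hinj hab), ← Finset.sum_div, ← hn]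
      push_cast
      congr 1
      refine Finset.sum_congr rfl fun ζ _ => ?_
      rw [div_mul_cancel₀ _ hρc]
  obtain ⟨L, hL⟩ := hyz
  refine ⟨L, hL.congr' ?_⟩
  filter_upwards [Filter.eventually_gt_atTop 0] with n hn
  have : 0 < (n : ℝ) ^ k * ρ ^ n := by
    have : (0 : ℝ) < n := by exact_mod_cast hn
    positivity
  simp only [div_pos_iff_of_pos_right this]

/-- Sequences that eventually coincide with an exponential polynomial. -/
def IsEP (f : ℕ → ℂ) : Prop :=
  ∃ S : Finset ℂ, ∃ P : ℂ → Polynomial ℂ, (∀ ζ ∈ S, ζ ≠ 0) ∧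
    ∀ᶠ n : ℕ in Filter.atTop, f n = ∑ ζ ∈ S, (P ζ).eval (n : ℂ) * ζ ^ n

lemma IsEP.zero : IsEP (fun _ => 0) := ⟨∅, fun _ => 0, by simp, by simp⟩

lemma IsEP.single (P : Polynomial ℂ) (ζ : ℂ) (h : ζ ≠ 0) :
    IsEP (fun n => P.eval (n : ℂ) * ζ ^ n) :=
  ⟨{ζ}, fun _ => P, by simpa using h, by simp⟩

lemma IsEP.add {f g : ℕ → ℂ} (hf : IsEP f) (hg : IsEP g) : IsEP (fun n => f n + g n) := by
  classical
  obtain ⟨S, P, hS, hP⟩ := hf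
  obtain ⟨T, Q, hT, hQ⟩ := hg
  refine ⟨S ∪ T, fun ζ => (if ζ ∈ S then P ζ else 0) + (if ζ ∈ T then Q ζ else 0), ?_, ?_⟩
  · intro ζ hζ
    rcases Finset.mem_union.1 hζ with h | h
    · exact hS _ h
    · exact hT _ h
  · filter_upwards [hP, hQ] with n h1 h2
    rw [h1, h2]
    simp only [Polynomial.eval_add, add_mul]
    rw [Finset.sum_add_distrib]
    congr 1
    · rw [← Finset.sum_subset (Finset.subset_union_left (s₁ := S) (s₂ := T))]
      · exact Finset.sum_congr rfl fun ζ hζ => by rw [if_pos hζ]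
      · intro ζ _ h; simp [h]
    · rw [← Finset.sum_subset (Finset.subset_union_right (s₁ := S) (s₂ := T))]
      · exact Finset.sum_congr rfl fun ζ hζ => by rw [if_pos hζ]
      · intro ζ _ h; simp [h]

lemma IsEP.const_mul {f : ℕ → ℂ} (c : ℂ) (hf : IsEP f) : IsEP (fun n => c * f n) := by
  obtain ⟨S, P, hS, hP⟩ := hf
  refine ⟨S, fun ζ => Polynomial.C c * P ζ, hS, ?_⟩
  filter_upwards [hP] with n h1
  rw [h1, Finset.mul_sum]
  simp [mul_assoc]

lemma IsEP.sum {ι : Type*} (s : Finset ι) (f : ι → ℕ → ℂ)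
    (h : ∀ i ∈ s, IsEP (f i)) : IsEP (fun n => ∑ i ∈ s, f i n) := by
  classical
  induction s using Finset.induction_on with
  | empty => simpa using IsEP.zero
  | insert a s ha ih =>
    simp only [Finset.sum_insert ha]
    exact (h a (by simp)).add (ih fun i hi => h i (by simp [hi]))

lemma exists_modulus (S : Finset ℂ) : ∃ M : ℕ, 0 < M ∧ ∀ ζ ∈ S, ∀ ξ ∈ S, ∀ h : ℕ, 0 < h →
    ζ ^ h = ξ ^ h → ζ ^ M = ξ ^ M := by
  have : ∀ p : ℂ × ℂ, ∃ k : ℕ, 0 < k ∧ ((∃ h : ℕ, 0 < h ∧ p.1 ^ h = p.2 ^ h) →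
      p.1 ^ k = p.2 ^ k) := by
    intro p
    by_cases hp : ∃ h : ℕ, 0 < h ∧ p.1 ^ h = p.2 ^ h
    · obtain ⟨h, h1, h2⟩ := hp
      exact ⟨h, h1, fun _ => h2⟩
    · exact ⟨1, one_pos, fun h => absurd h hp⟩
  choose k hk hk' using this
  refine ⟨∏ p ∈ S ×ˢ S, k p, Finset.prod_pos fun p _ => hk p, fun ζ hζ ξ hξ h hh he => ?_⟩
  have h1 := hk' (ζ, ξ) ⟨h, hh, he⟩
  obtain ⟨q, hq⟩ := Finset.dvd_prod_of_mem k (Finset.mk_mem_product hζ hξ)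
  simp only at h1
  rw [hq, pow_mul, pow_mul, h1]

open Classical in
lemma density_EP (y : ℕ → ℝ) (hy : IsEP (fun n => (y n : ℂ))) :
    ∃ L, HasMean (fun n => if 0 < y n then 1 else 0) L := by
  obtain ⟨S, P, hS, hP⟩ := hy
  obtain ⟨M, hM, hMS⟩ := exists_modulus S
  refine hasMean_of_progressions _ 1 (fun n => by split_ifs <;> simp) M hM fun a _ => ?_
  refine density_nondegenerate (fun m => y (M * m + a)) (S.image (fun ζ => ζ ^ M))
    (fun μ => ∑ ζ ∈ S with ζ ^ M = μ, Polynomial.C (ζ ^ a) *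
      (P ζ).comp (Polynomial.C (M : ℂ) * Polynomial.X + Polynomial.C (a : ℂ))) ?_ ?_ ?_
  · intro μ hμ
    obtain ⟨ζ, hζ, rfl⟩ := Finset.mem_image.1 hμ
    exact pow_ne_zero _ (hS ζ hζ)
  · intro μ hμ ν hν h hh he
    obtain ⟨ζ, hζ, rfl⟩ := Finset.mem_image.1 hμ
    obtain ⟨ξ, hξ, rfl⟩ := Finset.mem_image.1 hν
    rw [← pow_mul, ← pow_mul] at he
    exact hMS ζ hζ ξ hξ _ (Nat.mul_pos hM hh) he
  · have ht : Filter.Tendsto (fun m : ℕ => M * m + a) Filter.atTop Filter.atTop := by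
      refine Filter.tendsto_atTop_mono (fun m => ?_) Filter.tendsto_id
      have := Nat.le_mul_of_pos_left m hM
      simp only [id]; omega
    filter_upwards [ht.eventually hP] with m hm
    rw [hm, ← Finset.sum_fiberwise_of_maps_to (t := S.image (fun ζ => ζ ^ M))
      (g := fun ζ => ζ ^ M) (fun ζ hζ => Finset.mem_image_of_mem _ hζ)]
    refine Finset.sum_congr rfl fun μ _ => ?_
    rw [Polynomial.eval_finsetSum, Finset.sum_mul]
    refine Finset.sum_congr rfl fun ζ hζ => ?_
    rw [← (Finset.mem_filter.1 hζ).2]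
    simp only [Polynomial.eval_mul, Polynomial.eval_C, Polynomial.eval_comp, Polynomial.eval_add,
      Polynomial.eval_X]
    push_cast
    rw [pow_add, pow_mul]
    ring

/-- Shift on the solution space. -/
def shiftSol (E : LinearRecurrence ℂ) : Module.End ℂ E.solSpace where
  toFun x := ⟨fun n => x.1 (n + 1), by
    have hx := (E.is_sol_iff_mem_solSpace x.1).2 x.2
    rw [← E.is_sol_iff_mem_solSpace]
    intro n
    have := hx (n + 1)
    beta_reduce
    rw [show n + E.order + 1 = n + 1 + E.order by ring, this]
    exact Finset.sum_congr rfl fun i _ => by rw [show n + i + 1 = n + 1 + i by ring]⟩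
  map_add' x y := rfl
  map_smul' c x := rfl

lemma shiftSol_pow (E : LinearRecurrence ℂ) (n : ℕ) : ∀ (x : E.solSpace) (m : ℕ),
    ((shiftSol E ^ n) x).1 m = x.1 (m + n) := by
  induction n with
  | zero => intro x m; simp
  | succ n ih =>
    intro x m
    rw [pow_succ, Module.End.mul_apply, ih]
    change x.1 (m + n + 1) = _
    rfl

lemma isEP_genEigen (E : LinearRecurrence ℂ) (μ : ℂ) (x : E.solSpace)
    (hx : x ∈ (shiftSol E).maxGenEigenspace μ) : IsEP x.1 := by
  rw [Module.End.mem_maxGenEigenspace] at hx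
  obtain ⟨k, hk⟩ := hx
  set T : Module.End ℂ E.solSpace := shiftSol E - μ • 1 with hT
  have hTk : ∀ j, k ≤ j → (T ^ j) x = 0 := by
    intro j hj
    obtain ⟨i, rfl⟩ := Nat.exists_eq_add_of_le' hj
    rw [pow_add, Module.End.mul_apply, hk, map_zero]
  have hexp : ∀ n, x.1 n = ∑ j ∈ Finset.range (n + 1),
      ((n.choose j : ℂ) * μ ^ (n - j)) * ((T ^ j) x).1 0 := by
    intro n
    have h1 := shiftSol_pow E n x 0
    rw [zero_add] at h1
    have h2 : shiftSol E = T + μ • 1 := by rw [hT]; abel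
    have hc : Commute T (μ • 1 : Module.End ℂ E.solSpace) :=
      (Commute.one_right T).smul_right μ
    rw [← h1, h2, hc.add_pow]
    rw [LinearMap.sum_apply, Submodule.coe_sum, Finset.sum_apply]
    refine Finset.sum_congr rfl fun j _ => ?_
    rw [smul_pow, one_pow, mul_smul_comm, mul_one, ← nsmul_eq_mul', LinearMap.smul_apply,
      LinearMap.smul_apply]
    simp
    ring
  have hexp2 : ∀ n, k ≤ n → x.1 n = ∑ j ∈ Finset.range k,
      ((n.choose j : ℂ) * μ ^ (n - j)) * ((T ^ j) x).1 0 := by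
    intro n hn
    rw [hexp n]
    symm
    apply Finset.sum_subset
    · intro j; simp only [Finset.mem_range]; omega
    · intro j _ hj
      rw [Finset.mem_range, not_lt] at hj
      rw [hTk j hj]
      simp
  by_cases hμ : μ = 0
  · refine ⟨∅, fun _ => 0, by simp, ?_⟩
    filter_upwards [Filter.eventually_ge_atTop k] with n hn
    rw [hexp2 n hn, Finset.sum_empty]
    refine Finset.sum_eq_zero fun j hj => ?_
    rw [Finset.mem_range] at hj
    rw [hμ, zero_pow (by omega)]
    simp
  · refine ⟨{μ}, fun _ => ∑ j ∈ Finset.range k, Polynomial.C ((μ ^ j)⁻¹ * ((T ^ j) x).1 0 *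
      ((j.factorial : ℂ))⁻¹) * descPochhammer ℂ j, by simpa using hμ, ?_⟩
    filter_upwards [Filter.eventually_ge_atTop k] with n hn
    rw [hexp2 n hn, Finset.sum_singleton, Polynomial.eval_finsetSum, Finset.sum_mul]
    refine Finset.sum_congr rfl fun j hj => ?_
    rw [Finset.mem_range] at hj
    rw [Polynomial.eval_mul, Polynomial.eval_C, descPochhammer_eval_eq_descFactorial,
      Nat.descFactorial_eq_factorial_mul_choose, pow_sub₀ _ hμ (by omega)]
    have : (j.factorial : ℂ) ≠ 0 := by exact_mod_cast j.factorial_ne_zero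
    push_cast
    field_simp

lemma isEP_solution (E : LinearRecurrence ℂ) (f : ℕ → ℂ) (hf : E.IsSolution f) : IsEP f := by
  have : FiniteDimensional ℂ E.solSpace := Module.Finite.of_basis E.basis
  have htop := Module.End.iSup_maxGenEigenspace_eq_top (shiftSol E)
  have hmem : (⟨f, hf⟩ : E.solSpace) ∈ ⨆ μ, (shiftSol E).maxGenEigenspace μ := by
    rw [htop]; trivial
  have key : ∀ x : E.solSpace, x ∈ ⨆ μ, (shiftSol E).maxGenEigenspace μ → IsEP x.1 := by
    intro x hx
    induction hx using Submodule.iSup_induction' with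
    | mem μ x hx => exact isEP_genEigen E μ x hx
    | zero => exact IsEP.zero
    | add x y _ _ hx hy => exact hx.add hy
  exact key _ hmem

lemma isEP_of_recurrence (r : ℕ → ℝ) (hr : IsLinearRecurrence r) : IsEP (fun n => (r n : ℂ)) := by
  obtain ⟨h, _, c, hc⟩ := hr
  refine isEP_solution ⟨h, fun k => (c k : ℂ)⟩ _ ?_
  intro n
  have := hc n
  change ((r (n + h) : ℝ) : ℂ) = ∑ i : Fin h, (c i : ℂ) * (r (n + i) : ℂ)
  rw [this]
  push_cast
  rfl


lemma natDensity_of_mean (A : Set ℕ) [DecidablePred (· ∈ A)] (δ : ℝ)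
    (h : Filter.Tendsto (fun N : ℕ => (∑ n ∈ Finset.range N, if n ∈ A then (1 : ℝ) else 0) / N)
      Filter.atTop (nhds δ)) : HasNatDensity A δ := by
  unfold HasNatDensity
  have h1 := h.comp (Filter.tendsto_add_atTop_nat 1)
  have h2 : Filter.Tendsto (fun x : ℕ => ((x : ℝ) + 1) / x) Filter.atTop (nhds 1) := by
    have : Filter.Tendsto (fun x : ℕ => 1 + 1 / (x : ℝ)) Filter.atTop (nhds (1 + 0)) :=
      tendsto_const_nhds.add tendsto_one_div_atTop_nhds_zero_nat
    rw [add_zero] at this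
    refine this.congr' ?_
    filter_upwards [Filter.eventually_gt_atTop 0] with n hn
    have : (n : ℝ) ≠ 0 := by exact_mod_cast hn.ne'
    field_simp
  have h3 := h1.mul h2
  rw [mul_one] at h3
  refine h3.congr fun x => ?_
  have e : A ∩ Set.Iic x = (((Finset.range (x + 1)).filter (· ∈ A) : Finset ℕ) : Set ℕ) := by
    ext n
    simp only [Set.mem_inter_iff, Set.mem_Iic, Finset.coe_filter, Finset.mem_range,
      Set.mem_ofPred_eq]
    constructor
    · rintro ⟨a, b⟩; exact ⟨by omega, a⟩
    · rintro ⟨a, b⟩; exact ⟨b, by omega⟩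
  rw [e, Set.ncard_coe_finset]
  simp only [Function.comp]
  rw [Finset.sum_boole]
  push_cast
  rw [div_mul_div_cancel₀ (by positivity)]

/-- Reduction of a trigonometric sum to complex exponentials with frequencies `≠ 1`. -/
lemma trig_rep (d : ℕ) (θ a β : Fin d → ℝ) (hθ : ∀ i, Irrational (θ i)) :
    ∃ (ξ B : Fin d ⊕ Fin d → ℂ), (∀ j, ‖ξ j‖ = 1) ∧ (∀ j, ξ j ≠ 1) ∧
      ∀ n : ℕ, ((∑ i : Fin d, a i * Real.cos (2 * π * θ i * n + β i) : ℝ) : ℂ)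
        = ∑ j, B j * ξ j ^ n := by
  have hne : ∀ i, Complex.exp ((2 * π * θ i : ℝ) * Complex.I) ≠ 1 := by
    intro i h
    rw [Complex.exp_eq_one_iff] at h
    obtain ⟨m, hm⟩ := h
    have h2 : (θ i : ℂ) = m := by
      have hp : (2 * π * Complex.I : ℂ) ≠ 0 := Complex.two_pi_I_ne_zero
      apply mul_right_cancel₀ hp
      rw [← hm]
      push_cast
      ring
    have h3 : θ i = m := by exact_mod_cast h2
    exact (hθ i).ne_int m h3
  refine ⟨Sum.elim (fun i => Complex.exp ((2 * π * θ i : ℝ) * Complex.I))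
      (fun i => Complex.exp ((-(2 * π * θ i) : ℝ) * Complex.I)),
    Sum.elim (fun i => a i / 2 * Complex.exp ((β i : ℝ) * Complex.I))
      (fun i => a i / 2 * Complex.exp ((-β i : ℝ) * Complex.I)), ?_, ?_, ?_⟩
  · rintro (i | i)
    · exact Complex.norm_exp_ofReal_mul_I _
    · exact Complex.norm_exp_ofReal_mul_I _
  · rintro (i | i)
    · exact hne i
    · intro h
      apply hne i
      simp only [Sum.elim_inr] at h
      rw [Complex.ofReal_neg, neg_mul, Complex.exp_neg, inv_eq_one] at h
      exact h
  · intro n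
    rw [Fintype.sum_sum_type, ← Finset.sum_add_distrib]
    push_cast
    refine Finset.sum_congr rfl fun i _ => ?_
    simp only [Sum.elim_inl, Sum.elim_inr]
    rw [← Complex.exp_nat_mul, ← Complex.exp_nat_mul, Complex.cos, mul_assoc (_ / _),
      mul_assoc (_ / _), ← Complex.exp_add, ← Complex.exp_add]
    rw [show (2 * (π : ℂ) * θ i * n + β i) * Complex.I
      = β i * Complex.I + n * (2 * π * θ i * Complex.I) by ring,
      show -(2 * (π : ℂ) * θ i * n + β i) * Complex.I
      = -β i * Complex.I + n * (-(2 * π * θ i) * Complex.I) by ring]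
    ring

/-- Vanishing absolute mean forces a trigonometric polynomial to vanish. -/
lemma trig_eq_zero {ι : Type*} [Fintype ι] (ξ B : ι → ℂ) (h1 : ∀ j, ‖ξ j‖ = 1) (u : ℕ → ℂ)
    (hu : ∀ n, u n = ∑ j, B j * ξ j ^ n)
    (hm : Filter.Tendsto (fun N : ℕ => (∑ n ∈ Finset.range N, ‖u n‖) / (N : ℝ))
      Filter.atTop (nhds 0)) : ∀ n, u n = 0 := by
  classical
  set S : Finset ℂ := Finset.univ.image ξ with hS
  set c : ℂ → ℂ := fun ζ => ∑ j with ξ j = ζ, B j with hc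
  have hS1 : ∀ ζ ∈ S, ‖ζ‖ = 1 := by
    intro ζ hζ
    obtain ⟨j, _, rfl⟩ := Finset.mem_image.1 hζ
    exact h1 j
  have hrep : ∀ n, u n = ∑ ζ ∈ S, c ζ * ζ ^ n := by
    intro n
    rw [hu n, ← Finset.sum_fiberwise_of_maps_to (t := S) (g := ξ)
      (fun j hj => Finset.mem_image_of_mem _ hj)]
    refine Finset.sum_congr rfl fun ζ _ => ?_
    rw [hc, Finset.sum_mul]
    exact Finset.sum_congr rfl fun j hj => by rw [(Finset.mem_filter.1 hj).2]
  have hc0 : ∀ ζ ∈ S, c ζ = 0 := by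
    intro ζ hζ
    have hζ0 : ζ ≠ 0 := by
      rw [← norm_ne_zero_iff, hS1 ζ hζ]; exact one_ne_zero
    have hmean := HasMean.sum S (fun μ n => c μ * (μ / ζ) ^ n)
      (fun μ => c μ * (if μ / ζ = 1 then 1 else 0))
      (fun μ hμ => (hasMean_char (μ / ζ) (by rw [norm_div, hS1 μ hμ, hS1 ζ hζ, div_one])).const_mul _)
    have hval : ∑ μ ∈ S, c μ * (if μ / ζ = 1 then (1 : ℂ) else 0) = c ζ := by
      rw [Finset.sum_eq_single ζ]
      · simp [hζ0]
      · intro μ _ hne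
        rw [if_neg, mul_zero]
        rwa [div_eq_one_iff_eq hζ0]
      · intro h; exact absurd hζ h
    rw [hval] at hmean
    refine tendsto_nhds_unique hmean ?_
    rw [tendsto_zero_iff_norm_tendsto_zero]
    refine squeeze_zero (fun _ => norm_nonneg _) (fun N => ?_) hm
    rw [norm_div, Complex.norm_natCast]
    gcongr
    refine norm_sum_le_of_le _ fun n _ => ?_
    have : ∑ μ ∈ S, c μ * (μ / ζ) ^ n = u n / ζ ^ n := by
      rw [hrep n, Finset.sum_div]
      exact Finset.sum_congr rfl fun μ _ => by rw [div_pow, mul_div_assoc]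
    rw [this, norm_div, norm_pow, hS1 ζ hζ, one_pow, div_one]
  intro n
  rw [hrep n]
  exact Finset.sum_eq_zero fun ζ hζ => by rw [hc0 ζ hζ, zero_mul]

theorem pos_density_irrational_trigonometric_sum
    (d : ℕ) (θ a β : Fin d → ℝ) (hθ : ∀ i, Irrational (θ i))
    (u : ℕ → ℝ)
    (hu : ∀ n : ℕ, u n = ∑ i : Fin d, a i * Real.cos (2 * π * θ i * n + β i))
    (hune : ∃ n : ℕ, u n ≠ 0)
    (r : ℕ → ℝ) (hr : IsLinearRecurrence r)
    (hr0 : Filter.Tendsto r Filter.atTop (nhds 0)) :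
    ∃ δ : ℝ, 0 < δ ∧ HasNatDensity {n : ℕ | r n < u n} δ := by
  classical
  obtain ⟨ξ, B, hξ1, hξne, hrep⟩ := trig_rep d θ a β hθ
  have hurep : ∀ n : ℕ, (u n : ℂ) = ∑ j, B j * ξ j ^ n := fun n => by rw [hu n, hrep n]
  -- the mean of `u` is zero
  have hmean : HasMean (fun n => (u n : ℂ)) 0 := by
    have := HasMean.sum Finset.univ (fun j n => B j * ξ j ^ n) (fun _ => (0 : ℂ))
      (fun j _ => by simpa [hξne j] using (hasMean_char (ξ j) (hξ1 j)).const_mul (B j))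
    simpa [← hurep] using this
  have hmeanR : Filter.Tendsto (fun N : ℕ => (∑ n ∈ Finset.range N, u n) / (N : ℝ))
      Filter.atTop (nhds 0) := by
    have := (Complex.continuous_re.tendsto _).comp hmean
    rw [Complex.zero_re] at this
    refine this.congr fun N => ?_
    simp only [Function.comp]
    rw [← Complex.ofReal_sum, ← Complex.ofReal_natCast, ← Complex.ofReal_div, Complex.ofReal_re]
  -- the density exists
  have hEPu : IsEP (fun n => (u n : ℂ)) := by
    have := IsEP.sum Finset.univ (fun j n => B j * ξ j ^ n) (fun j _ => by
      have h0 : ξ j ≠ 0 := by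
        rw [← norm_ne_zero_iff, hξ1 j]; exact one_ne_zero
      simpa using IsEP.single (Polynomial.C (B j)) (ξ j) h0)
    simpa [← hurep] using this
  have hEP : IsEP (fun n => ((u n - r n : ℝ) : ℂ)) := by
    have := hEPu.add ((isEP_of_recurrence r hr).const_mul (-1))
    have e : (fun n => ((u n - r n : ℝ) : ℂ)) = fun n => (u n : ℂ) + -1 * (r n : ℂ) := by
      ext n
      push_cast
      ring
    rw [e]
    exact this
  obtain ⟨L, hL⟩ := density_EP _ hEP
  have hD : Filter.Tendsto (fun N : ℕ => (∑ n ∈ Finset.range N,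
      if n ∈ {n : ℕ | r n < u n} then (1 : ℝ) else 0) / N) Filter.atTop (nhds L.re) := by
    have := (Complex.continuous_re.tendsto _).comp hL
    refine this.congr fun N => ?_
    simp only [Function.comp, sub_pos, Set.mem_ofPred_eq]
    rw [← Complex.ofReal_re ((∑ n ∈ Finset.range N, if r n < u n then (1 : ℝ) else 0) / N)]
    congr 1
    push_cast
    congr 1
    exact Finset.sum_congr rfl fun n _ => by split_ifs <;> simp
  refine ⟨L.re, ?_, natDensity_of_mean _ _ hD⟩
  have hnonneg : 0 ≤ L.re := ge_of_tendsto' hD fun N => by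
    refine div_nonneg (Finset.sum_nonneg fun n _ => ?_) (Nat.cast_nonneg _)
    split_ifs <;> norm_num
  refine lt_of_le_of_ne hnonneg fun hz => ?_
  rw [← hz] at hD
  -- density zero forces `u = 0`
  set C : ℝ := ∑ j, ‖B j‖ with hC
  have huC : ∀ n, |u n| ≤ C := by
    intro n
    rw [← Real.norm_eq_abs, ← Complex.norm_real, hurep n]
    refine norm_sum_le_of_le _ fun j _ => ?_
    rw [norm_mul, norm_pow, hξ1 j, one_pow, mul_one]
  clear_value C
  have hces := (hr0.abs).cesaro
  rw [abs_zero] at hces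
  have hub := ((hD.const_mul (2 * C)).add (hces.const_mul 2)).sub hmeanR
  simp only [mul_zero, add_zero, sub_zero] at hub
  have habs : Filter.Tendsto (fun N : ℕ => (∑ n ∈ Finset.range N, ‖(u n : ℂ)‖) / (N : ℝ))
      Filter.atTop (nhds 0) := by
    refine squeeze_zero (fun N => div_nonneg (Finset.sum_nonneg fun n _ => norm_nonneg _)
      (Nat.cast_nonneg _)) (fun N => ?_) hub
    have hle : ∑ n ∈ Finset.range N, ‖(u n : ℂ)‖ ≤ 2 * C * (∑ n ∈ Finset.range N,
        if n ∈ {n : ℕ | r n < u n} then (1 : ℝ) else 0) + 2 * ∑ n ∈ Finset.range N, |r n|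
        - ∑ n ∈ Finset.range N, u n := by
      rw [Finset.mul_sum, Finset.mul_sum, ← Finset.sum_add_distrib, ← Finset.sum_sub_distrib]
      refine Finset.sum_le_sum fun n _ => ?_
      rw [Complex.norm_real, Real.norm_eq_abs]
      have h1 := huC n
      have h2 := abs_nonneg (r n)
      have h3 := le_abs_self (r n)
      simp only [Set.mem_ofPred_eq]
      split_ifs with h
      · have := neg_abs_le (u n)
        have := le_abs_self (u n)
        linarith
      · rcases abs_cases (u n) with ⟨e, _⟩ | ⟨e, _⟩ <;> rw [e] <;> linarith
    calc _ ≤ _ := div_le_div_of_nonneg_right hle (Nat.cast_nonneg N)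
      _ = _ := by ring
  obtain ⟨n, hn⟩ := hune
  have := trig_eq_zero ξ B hξ1 (fun n => (u n : ℂ)) hurep habs n
  exact hn (by exact_mod_cast this)
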